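/- arXiv:1906.01683 — 2 statements merged into one kernel-verified Lean document; each statement's English description precedes it below -/
import Mathlib

section
/- Let N ≥ 1, and for each i ∈ {1,…,N} let Cᵢ : ℝ → ℝ be convex and differentiable with Cᵢ' ≥ 0 everywhere, and let qᵢ : ℝ → ℝ be concave and differentiable. Let β ≥ 0 and Q ∈ ℝ, and define the per-period social cost Λ(p) = ∑ᵢ Cᵢ(qᵢ(p)) + β·max(Q − ∑ᵢ qᵢ(p), 0). Then for all p, p* ∈ ℝ: Λ(p) − Λ(p*) ≤ β·max((∑ᵢ qᵢ'(p))·(p* − p), 0) − ∑ᵢ Cᵢ'(qᵢ(p))·(qᵢ(p*) − qᵢ(p)). -/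
open Finset

/-- A convex function on the line lies above each of its tangent lines. -/
theorem ConvexOn.deriv_mul_sub_le {f : ℝ → ℝ} (hf : ConvexOn ℝ Set.univ f) {x : ℝ}
    (hx : DifferentiableAt ℝ f x) (y : ℝ) : deriv f x * (y - x) ≤ f y - f x := by
  rcases lt_trichotomy x y with h | rfl | h
  · have hs := hf.deriv_le_slope (Set.mem_univ x) (Set.mem_univ y) h hx
    rwa [slope_def_field, le_div_iff₀ (sub_pos.2 h)] at hs
  · simp
  · have hs := hf.slope_le_deriv (Set.mem_univ y) (Set.mem_univ x) h hx
    rw [slope_def_field, div_le_iff₀ (sub_pos.2 h)] at hs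
    linarith

/-- A concave function on the line lies below each of its tangent lines. -/
theorem ConcaveOn.sub_le_deriv_mul {f : ℝ → ℝ} (hf : ConcaveOn ℝ Set.univ f) {x : ℝ}
    (hx : DifferentiableAt ℝ f x) (y : ℝ) : f y - f x ≤ deriv f x * (y - x) := by
  have h := hf.neg.deriv_mul_sub_le hx.neg y
  simp only [deriv.neg, Pi.neg_apply] at h
  linarith

/-- Key per-step first-order bound in the regret analysis (Lemma 3): with
`Λ(p) = ∑ᵢ Cᵢ(qᵢ(p)) + β·[Q − ∑ᵢ qᵢ(p)]⁺`, for all prices `p, p*` one has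
`Λ(p) − Λ(p*) ≤ β·[(∑ᵢ qᵢ'(p))·(p* − p)]⁺ − ∑ᵢ Cᵢ'(qᵢ(p))·(qᵢ(p*) − qᵢ(p))`. -/
theorem per_step_first_order_bound (N : ℕ) (hN : 1 ≤ N)
    (C : Fin N → ℝ → ℝ) (hCconv : ∀ i, ConvexOn ℝ Set.univ (C i))
    (hCdiff : ∀ i, Differentiable ℝ (C i))
    (hCmono : ∀ i x, 0 ≤ deriv (C i) x)
    (q : Fin N → ℝ → ℝ) (hqconc : ∀ i, ConcaveOn ℝ Set.univ (q i))
    (hqdiff : ∀ i, Differentiable ℝ (q i))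
    (β : ℝ) (hβ : 0 ≤ β) (Q : ℝ)
    (Λ : ℝ → ℝ)
    (hΛ : ∀ p, Λ p = ∑ i, C i (q i p) + β * max (Q - ∑ i, q i p) 0) :
    ∀ p pstar : ℝ,
      Λ p - Λ pstar ≤
        β * max ((∑ i, deriv (q i) p) * (pstar - p)) 0
          - ∑ i, deriv (C i) (q i p) * (q i pstar - q i p) := by
  intro p pstar
  have hcost : ∑ i, deriv (C i) (q i p) * (q i pstar - q i p) ≤
      ∑ i, C i (q i pstar) - ∑ i, C i (q i p) := by
    rw [← sum_sub_distrib]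
    exact sum_le_sum fun i _ ↦ (hCconv i).deriv_mul_sub_le (hCdiff i _) _
  have hoffload : ∑ i, q i pstar - ∑ i, q i p ≤ (∑ i, deriv (q i) p) * (pstar - p) := by
    rw [← sum_sub_distrib, sum_mul]
    exact sum_le_sum fun i _ ↦ (hqconc i).sub_le_deriv_mul (hqdiff i p) _
  have hunmet : max (Q - ∑ i, q i p) 0 ≤
      max ((∑ i, deriv (q i) p) * (pstar - p)) 0 + max (Q - ∑ i, q i pstar) 0 :=
    max_le
      (by linarith [le_max_left ((∑ i, deriv (q i) p) * (pstar - p)) 0,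
        le_max_left (Q - ∑ i, q i pstar) 0])
      (add_nonneg (le_max_right _ _) (le_max_right _ _))
  have hpenalty := mul_le_mul_of_nonneg_left hunmet hβ
  rw [hΛ, hΛ]
  linarith
end

section
/- Let T ≥ 1, p̄ > 0, G > 0, and p* ∈ [0, p̄]. Let (η_t)_{t=1}^T be positive, let (G_t)_{t=1}^T satisfy 0 < G_t ≤ G, let (k_t)_{t=1}^T satisfy k_t ≥ 0, and suppose the weights w_t := k_t/(η_t·G_t) are nondecreasing in t. Let p₁ ∈ [0, p̄] and define p_{t+1} = max(p_t − η_t·G_t, 0) for t = 1,…,T. Then ∑_{t=1}^T k_t·(p_t − p*) ≤ p̄²·k_T/(2·η_T·G_T) + ∑_{t=1}^T η_t·G²·k_t/(2·G_t). -/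
open Finset

/-- Abel summation: a nondecreasing weighting of the decrements of a sequence bounded above by `B`
sums to at most the last weight times the gap between `B` and the final term. -/
theorem sum_Icc_mul_sub_succ_le {n : ℕ} (hn : 1 ≤ n) {w D : ℕ → ℝ} {B : ℝ}
    (hw₁ : 0 ≤ w 1) (hw : ∀ t, 1 ≤ t → t < n → w t ≤ w (t + 1))
    (hD : ∀ t ∈ Icc 1 n, D t ≤ B) :
    ∑ t ∈ Icc 1 n, w t * (D t - D (t + 1)) ≤ w n * (B - D (n + 1)) := by
  induction n, hn using Nat.le_induction with
  | base =>
    have := hD 1 (by simp)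
    simp only [Icc_self, sum_singleton]
    gcongr
  | succ n hn ih =>
    rw [sum_Icc_succ_top (by omega)]
    have hsum := ih (fun t h1 h2 => hw t h1 (by omega))
      (fun t ht => hD t (by simp only [mem_Icc] at ht ⊢; omega))
    have hstep := hw n hn (by omega)
    have hbound := hD (n + 1) (by simp)
    nlinarith [mul_nonneg (sub_nonneg.2 hstep) (sub_nonneg.2 hbound)]

/-- One projected step of length `a` towards the nonnegative half-line does not increase the
distance to a nonnegative comparator beyond that of the unprojected step. -/
theorem two_mul_mul_sub_le_of_projected_step {x y a : ℝ} (hy : 0 ≤ y) :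
    2 * (a * (x - y)) ≤ (x - y) ^ 2 - (max (x - a) 0 - y) ^ 2 + a ^ 2 := by
  rcases max_cases (x - a) 0 with ⟨h, _⟩ | ⟨h, _⟩ <;> rw [h] <;> nlinarith

/-- Abel-summation regret bound of Lemma 3: with projected updates
`p_{t+1} = max(p_t − η_t·G_t, 0)`, weights `k_t ≥ 0` such that `k_t/(η_t·G_t)` is
nondecreasing, and `0 < G_t ≤ G`, one has
`∑_{t=1}^T k_t·(p_t − p*) ≤ p̄²·k_T/(2 η_T G_T) + ∑_{t=1}^T η_t·G²·k_t/(2 G_t)`. -/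
theorem regret_abel_bound (T : ℕ) (hT : 1 ≤ T) (pbar : ℝ) (hpbar : 0 < pbar)
    (G : ℝ) (hG : 0 < G) (pstar : ℝ) (hpstar : pstar ∈ Set.Icc 0 pbar)
    (η : ℕ → ℝ) (hηpos : ∀ t ∈ Icc 1 T, 0 < η t)
    (Gt : ℕ → ℝ) (hGt : ∀ t ∈ Icc 1 T, 0 < Gt t ∧ Gt t ≤ G)
    (k : ℕ → ℝ) (hk : ∀ t ∈ Icc 1 T, 0 ≤ k t)
    (hw : ∀ s ∈ Icc 1 T, ∀ t ∈ Icc 1 T, s ≤ t →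
      k s / (η s * Gt s) ≤ k t / (η t * Gt t))
    (p : ℕ → ℝ) (hp1 : p 1 ∈ Set.Icc 0 pbar)
    (hupd : ∀ t ∈ Icc 1 T, p (t + 1) = max (p t - η t * Gt t) 0) :
    ∑ t ∈ Icc 1 T, k t * (p t - pstar) ≤
      pbar ^ 2 * k T / (2 * η T * Gt T)
        + ∑ t ∈ Icc 1 T, η t * G ^ 2 * k t / (2 * Gt t) := by
  have hp : ∀ t, 1 ≤ t → t ≤ T → p t ∈ Set.Icc 0 pbar := by
    intro t ht
    induction t, ht using Nat.le_induction with
    | base => exact fun _ => hp1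
    | succ t ht ih =>
      intro htT
      have hmem : t ∈ Icc 1 T := mem_Icc.2 ⟨ht, by omega⟩
      have hpt := ih (by omega)
      have hpos := mul_pos (hηpos t hmem) (hGt t hmem).1
      rw [hupd t hmem]
      exact ⟨le_max_right _ _, max_le (by linarith [hpt.2]) hpbar.le⟩
  have hstep : ∀ t ∈ Icc 1 T, k t * (p t - pstar) ≤
      k t / (η t * Gt t) * ((p t - pstar) ^ 2 - (p (t + 1) - pstar) ^ 2) / 2
        + η t * G ^ 2 * k t / (2 * Gt t) := by
    intro t ht
    have hη := hηpos t ht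
    obtain ⟨hg, hgG⟩ := hGt t ht
    have hkt := hk t ht
    have hproj := two_mul_mul_sub_le_of_projected_step (x := p t) (a := η t * Gt t) hpstar.1
    rw [← hupd t ht] at hproj
    have hw0 : 0 ≤ k t / (η t * Gt t) := by positivity
    have hmul := mul_le_mul_of_nonneg_left hproj hw0
    have hleft : k t / (η t * Gt t) * (2 * (η t * Gt t * (p t - pstar))) =
        2 * (k t * (p t - pstar)) := by
      field_simp
    have hsq : k t / (η t * Gt t) * (η t * Gt t) ^ 2 = 2 * (η t * Gt t ^ 2 * k t / (2 * Gt t)) := by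
      field_simp
    have hgrad : η t * Gt t ^ 2 * k t / (2 * Gt t) ≤ η t * G ^ 2 * k t / (2 * Gt t) := by
      gcongr
    rw [mul_add, hleft, hsq] at hmul
    linarith
  have hmem1 : 1 ∈ Icc 1 T := mem_Icc.2 ⟨le_rfl, hT⟩
  have hmemT : T ∈ Icc 1 T := mem_Icc.2 ⟨hT, le_rfl⟩
  have hwnonneg : ∀ t ∈ Icc 1 T, 0 ≤ k t / (η t * Gt t) := fun t ht =>
    div_nonneg (hk t ht) (mul_pos (hηpos t ht) (hGt t ht).1).le
  have habel := sum_Icc_mul_sub_succ_le hT (w := fun t => k t / (η t * Gt t))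
    (D := fun t => (p t - pstar) ^ 2) (B := pbar ^ 2) (hwnonneg 1 hmem1)
    (fun t h1 h2 => hw t (mem_Icc.2 ⟨h1, h2.le⟩) (t + 1) (mem_Icc.2 ⟨by omega, h2⟩) (by omega))
    (fun t ht => by
      obtain ⟨h0, h1⟩ := hp t (mem_Icc.1 ht).1 (mem_Icc.1 ht).2
      exact sq_le_sq' (by linarith [hpstar.2]) (by linarith [hpstar.1]))
  have hlast : k T / (η T * Gt T) * pbar ^ 2 / 2 = pbar ^ 2 * k T / (2 * η T * Gt T) := by
    have := (hηpos T hmemT).ne'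
    have := (hGt T hmemT).1.ne'
    field_simp
  have hdrop := mul_nonneg (hwnonneg T hmemT) (sq_nonneg (p (T + 1) - pstar))
  have hsum := sum_le_sum hstep
  rw [sum_add_distrib, ← sum_div] at hsum
  simp only [mul_sub (k T / (η T * Gt T))] at habel
  linarith
end
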